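/- Let (A_S,S) be an Artin-Tits system of spherical type, X ⊆ S, g ∈ H_X and s,t ∈ X. Then sg = gt in A_S if and only if s·p(g) = p(g)·t in W_S, where p: A_S → W_S is the canonical projection. -/

import Mathlib

/-!
Common definitions for formalizing "Normalisateur des sous-groupes paraboliques
des groupes d'Artin-Tits" (E. Godelle).

We fix a Coxeter matrix `M` over a finite index set `B` (Mathlib's convention:
`M s t = 0` encodes `m_{s,t} = ∞`).  The Artin-Tits group `Artin M` is the
presented group on the braid relations, the Coxeter group is Mathlib's
`M.Group`, and `proj : Artin M →* M.Group` is the canonical projection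
(adding the relations `s² = 1`).
-/

namespace ArtinTitsPaper

open List

variable {B : Type*}

/-- The alternating list `[s, t, s, t, ...]` with `n` terms, starting with `s`. -/
def altList (s t : B) : ℕ → List B
  | 0 => []
  | n + 1 => s :: altList t s n

/-- The braid relators `(sts⋯)(tst⋯)⁻¹` (`m_{s,t}` letters each) for `s ≠ t`,
`m_{s,t} ≠ ∞`. -/
def braidRels (M : CoxeterMatrix B) : Set (FreeGroup B) :=
  { r | ∃ s t : B, s ≠ t ∧ M s t ≠ 0 ∧
      r = ((altList s t (M s t)).map FreeGroup.of).prod *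
          (((altList t s (M s t)).map FreeGroup.of).prod)⁻¹ }

/-- The Artin-Tits group associated to the Coxeter matrix `M`. -/
def Artin (M : CoxeterMatrix B) : Type _ := PresentedGroup (braidRels M)

instance (M : CoxeterMatrix B) : Group (Artin M) :=
  QuotientGroup.Quotient.group _

/-- The standard generator of `Artin M` indexed by `s : B` (the image of `S` in `A_S`). -/
def gen (M : CoxeterMatrix B) (s : B) : Artin M := PresentedGroup.of s

theorem altList_eq_reverse_alternatingWord (s t : B) (n : ℕ) :
    altList s t n = (CoxeterSystem.alternatingWord t s n).reverse := by
  induction n generalizing s t with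
  | zero => rfl
  | succ n ih =>
      rw [altList, CoxeterSystem.alternatingWord_succ, List.concat_eq_append,
        List.reverse_append]
      simp [ih]

theorem lift_simple_listProd (M : CoxeterMatrix B) (l : List B) :
    FreeGroup.lift M.simple ((l.map FreeGroup.of).prod) =
      M.toCoxeterSystem.wordProd l := by
  rw [CoxeterSystem.wordProd, map_list_prod, List.map_map]
  simp [Function.comp_def, CoxeterMatrix.toCoxeterSystem_simple]

theorem braid_lift (M : CoxeterMatrix B) :
    ∀ r ∈ braidRels M, FreeGroup.lift M.simple r = 1 := by
  rintro r ⟨s, t, hst, hm, rfl⟩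
  rw [map_mul, map_inv, lift_simple_listProd, lift_simple_listProd,
    altList_eq_reverse_alternatingWord, altList_eq_reverse_alternatingWord,
    CoxeterSystem.wordProd_reverse, CoxeterSystem.wordProd_reverse]
  have hsym : M s t = M t s := M.symmetric s t
  have hb := M.toCoxeterSystem.wordProd_braidWord_eq t s
  rw [CoxeterSystem.braidWord, CoxeterSystem.braidWord, ← hsym] at hb
  rw [hb]
  simp

/-- The canonical projection from the Artin-Tits group onto the Coxeter group
(adding the relations `s² = 1`). -/
def proj (M : CoxeterMatrix B) : Artin M →* M.Group :=
  PresentedGroup.toGroup (braid_lift M)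

/-- The positive monoid `A_S⁺`, the submonoid of `A_S` generated by `S`. -/
def posMon (M : CoxeterMatrix B) : Submonoid (Artin M) :=
  Submonoid.closure (Set.range (gen M))

/-- The submonoid `A_X⁺` of `A_S` generated by `X ⊆ S`. -/
def posMonOn (M : CoxeterMatrix B) (X : Set B) : Submonoid (Artin M) :=
  Submonoid.closure (gen M '' X)

/-- The standard parabolic subgroup `A_X` of `A_S` generated by `X ⊆ S`. -/
def stdSub (M : CoxeterMatrix B) (X : Set B) : Subgroup (Artin M) :=
  Subgroup.closure (gen M '' X)

/-- The standard parabolic subgroup `W_X` of the Coxeter group `W_S`. -/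
def coxSub (M : CoxeterMatrix B) (X : Set B) : Subgroup M.Group :=
  Subgroup.closure (M.simple '' X)

/-- `X ⊆ S` is of spherical type if the Coxeter group `W_X` is finite. -/
def IsSpherical (M : CoxeterMatrix B) (X : Set B) : Prop :=
  Finite (coxSub M X)

/-- `a` left-divides `b` in the positive monoid: `b = a c` with `c ∈ A_S⁺`. -/
def ldvd (M : CoxeterMatrix B) (a b : Artin M) : Prop :=
  ∃ c ∈ posMon M, a * c = b

/-- `a` right-divides `b` in the positive monoid: `b = c a` with `c ∈ A_S⁺`. -/
def rdvd (M : CoxeterMatrix B) (a b : Artin M) : Prop :=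
  ∃ c ∈ posMon M, c * a = b

/-- `d` is the least common multiple `Δ_X` of `X` in `A_X⁺` (for left-divisibility). -/
def IsDelta (M : CoxeterMatrix B) (X : Set B) (d : Artin M) : Prop :=
  d ∈ posMonOn M X ∧
  (∀ s ∈ X, ∃ c ∈ posMonOn M X, gen M s * c = d) ∧
  ∀ m ∈ posMonOn M X, (∀ s ∈ X, ∃ c ∈ posMonOn M X, gen M s * c = m) →
    ∃ c ∈ posMonOn M X, d * c = m

/-- The subset `Xg = {σ_x g : x ∈ X}` of `A_S`. -/
def leftMul (M : CoxeterMatrix B) (X : Set B) (g : Artin M) : Set (Artin M) :=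
  (fun x => gen M x * g) '' X

/-- The subset `gX = {g σ_x : x ∈ X}` of `A_S`. -/
def rightMul (M : CoxeterMatrix B) (X : Set B) (g : Artin M) : Set (Artin M) :=
  (fun x => g * gen M x) '' X

/-- `Conj(S;X,Y) = {g ∈ A_S : gX = Yg}`. -/
def conjSet (M : CoxeterMatrix B) (X Y : Set B) : Set (Artin M) :=
  { g | rightMul M X g = leftMul M Y g }

/-- `Conj⁺(S;X,Y) = {g ∈ A_S⁺ : gX = Yg}`. -/
def conjPos (M : CoxeterMatrix B) (X Y : Set B) : Set (Artin M) :=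
  { g | g ∈ posMon M ∧ rightMul M X g = leftMul M Y g }

/-- The quasi-centralizer `QZ_{A_S}(A_X) = {g ∈ A_S : gX = Xg}`. -/
def QZset (M : CoxeterMatrix B) (X : Set B) : Set (Artin M) :=
  conjSet M X X

/-- The indecomposable component of `Z` containing `t` (vertices of `Z` joined to `t`
by a path of edges `m_{a,b} ≠ 2` in the Coxeter diagram on `Z`). -/
def comp (M : CoxeterMatrix B) (Z : Set B) (t : B) : Set B :=
  { s ∈ Z | Relation.ReflTransGen (fun a b => a ∈ Z ∧ b ∈ Z ∧ a ≠ b ∧ M a b ≠ 2) t s }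

/-- `Z` is indecomposable: it admits no nontrivial partition `Z = Z₁ ∪ Z₂` with
`m_{a,b} = 2` for `a ∈ Z₁`, `b ∈ Z₂`. -/
def Indecomp (M : CoxeterMatrix B) (Z : Set B) : Prop :=
  ¬ ∃ Z₁ Z₂ : Set B, Z₁.Nonempty ∧ Z₂.Nonempty ∧ Z₁ ∪ Z₂ = Z ∧ Disjoint Z₁ Z₂ ∧
      ∀ a ∈ Z₁, ∀ b ∈ Z₂, M a b = 2

/-- `g` is an elementary positive `Y`-ribbon-`X`: `g = d_{X,t}` for some `t ∈ S` with
`X(t)` of spherical type, where `d_{X,t} = Δ_{X(t)}` if `t ∈ X` and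
`d_{X,t} = Δ_{X(t)} Δ_{X(t)∖{t}}⁻¹` otherwise, and `Y ⊆ X ∪ {t}` satisfies `Yg = gX`. -/
def IsElemRibbon (M : CoxeterMatrix B) (X Y : Set B) (g : Artin M) : Prop :=
  ∃ t : B, IsSpherical M (comp M (X ∪ {t}) t) ∧
    ((t ∈ X ∧ IsDelta M (comp M (X ∪ {t}) t) g) ∨
      (t ∉ X ∧ ∃ d₁ d₂ : Artin M, IsDelta M (comp M (X ∪ {t}) t) d₁ ∧
        IsDelta M ((comp M (X ∪ {t}) t) \ {t}) d₂ ∧ g = d₁ * d₂⁻¹)) ∧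
    Y ⊆ X ∪ {t} ∧ leftMul M Y g = rightMul M X g

/-- `g` is a positive `Y`-ribbon-`X`: a product `g = g_n ⋯ g_1` of elementary positive
`X_i`-ribbons-`X_{i-1}` with `X_0 = X`, `X_n = Y`. -/
inductive IsRibbon (M : CoxeterMatrix B) : Set B → Set B → Artin M → Prop
  | nil (X : Set B) : IsRibbon M X X 1
  | cons {X Y Z : Set B} {g h : Artin M} :
      IsRibbon M X Y g → IsElemRibbon M Y Z h → IsRibbon M X Z (h * g)

/-- `g` is `X`-reduced: no element of `X` left-divides `g`. -/
def lreduced (M : CoxeterMatrix B) (X : Set B) (g : Artin M) : Prop :=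
  ∀ s ∈ X, ¬ ldvd M (gen M s) g

/-- `g` is reduced-`X`: no element of `X` right-divides `g`. -/
def rreduced (M : CoxeterMatrix B) (X : Set B) (g : Artin M) : Prop :=
  ∀ s ∈ X, ¬ rdvd M (gen M s) g

/-- The set `H_X` of elements `g₁ g₂⁻¹` where `g₁, g₂` are `X`-reduced positive
`X`-ribbons-`X`. -/
def HXset (M : CoxeterMatrix B) (X : Set B) : Set (Artin M) :=
  { g | ∃ g₁ g₂ : Artin M, IsRibbon M X X g₁ ∧ lreduced M X g₁ ∧
      IsRibbon M X X g₂ ∧ lreduced M X g₂ ∧ g = g₁ * g₂⁻¹ }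

/-- The length of a positive element (the common length of its expressions as words
in the generators; junk value `0` outside of `A_S⁺`). -/
noncomputable def len (M : CoxeterMatrix B) (g : Artin M) : ℕ :=
  sInf { n | ∃ l : List B, l.length = n ∧ (l.map (gen M)).prod = g }

/-- The length of an element of the Coxeter group `W_S`. -/
noncomputable def wlen (M : CoxeterMatrix B) (w : M.Group) : ℕ :=
  sInf { n | ∃ l : List B, l.length = n ∧ (l.map M.simple).prod = w }

/-- `g ∈ A_{S,red}`: `g` is positive and has the same length as its image in `W_S`. -/
def Red (M : CoxeterMatrix B) (g : Artin M) : Prop :=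
  g ∈ posMon M ∧ len M g = wlen M (proj M g)

/-- `C` is a simple `s`-chain-`u`: either `C = 1` and `s = u`, or
`C = tst⋯` (`k` letters, `k < m_{s,t}`) with `u ∈ {s,t}` and `C·u = tst⋯` (`k+1` letters). -/
def IsSimpleChain (M : CoxeterMatrix B) (s u : B) (C : Artin M) : Prop :=
  (C = 1 ∧ s = u) ∨
  ∃ t : B, t ≠ s ∧ (u = s ∨ u = t) ∧ ∃ k : ℕ,
    (M s t = 0 ∨ k < M s t) ∧
    C = ((altList t s k).map (gen M)).prod ∧
    C * gen M u = ((altList t s (k + 1)).map (gen M)).prod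

/-- `C` is an `s`-chain-`t`: a product `C₁ ⋯ C_k` of simple chains composing from
origin `s` to target `t`. -/
inductive IsChain (M : CoxeterMatrix B) : B → B → Artin M → Prop
  | single {s u : B} {C : Artin M} : IsSimpleChain M s u C → IsChain M s u C
  | comp {s u v : B} {C D : Artin M} :
      IsChain M s u C → IsSimpleChain M u v D → IsChain M s v (C * D)


open Polynomial.Chebyshev Module in
/-- The product of two reflections whose roots meet at the angle `π - π / m` has order
dividing `m`. -/
theorem reflection_mul_reflection_pow_eq_one {V : Type*} [AddCommGroup V] [Module ℝ V]
    {x y : V} {f g : Dual ℝ V} (hf : f x = 2) (hg : g y = 2) {m : ℕ} (hm : 2 ≤ m)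
    (hfy : f y = -2 * Real.cos (Real.pi / m)) (hgx : g x = -2 * Real.cos (Real.pi / m)) :
    (reflection hf * reflection hg) ^ m = 1 := by
  obtain rfl | hm2 := hm.eq_or_lt
  · norm_num at hfy hgx
    ext z
    rw [reflection_mul_reflection_pow_apply hf hg 2 z (-2) (by rw [hfy, hgx]; norm_num)]
    norm_num [hfy, hgx]
    abel
  have hm0 : (0 : ℝ) < m := by positivity
  have hmR : (2 : ℝ) < m := by exact_mod_cast hm2
  have htrace : 2 * Real.cos (2 * (Real.pi / m)) = f y * g x - 2 := by
    rw [hfy, hgx, Real.cos_two_mul]; ring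
  have hsin : Real.sin (2 * (Real.pi / m)) ≠ 0 := by
    refine (Real.sin_pos_of_pos_of_lt_pi (by positivity) ?_).ne'
    rw [← mul_div_assoc, div_lt_iff₀ hm0]
    nlinarith [Real.pi_pos]
  have hS (n : ℤ) := S_two_mul_real_cos (2 * (Real.pi / m)) n
  ext z
  rw [reflection_mul_reflection_pow_apply hf hg m z _ htrace]
  obtain ⟨k, rfl | rfl⟩ := m.even_or_odd'
  · have hzero : (S ℝ (k - 1)).eval (2 * Real.cos (2 * (Real.pi / (2 * k : ℕ)))) = 0 := by
      refine (mul_eq_zero_iff_right hsin).mp ?_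
      rw [hS]
      convert Real.sin_pi using 2
      have hk : (k : ℝ) ≠ 0 := by
        rintro hk
        simp [hk] at hm0
      push_cast
      field_simp
      ring
    have h₁ : (((2 * k : ℕ) : ℤ) - 2) / 2 = k - 1 := by lia
    have h₂ : (((2 * k : ℕ) : ℤ) - 1) / 2 = k - 1 := by lia
    simp only [h₁, h₂, hzero]
    simp
  · have hzero : (S ℝ k).eval (2 * Real.cos (2 * (Real.pi / (2 * k + 1 : ℕ)))) +
        (S ℝ (k - 1)).eval (2 * Real.cos (2 * (Real.pi / (2 * k + 1 : ℕ)))) = 0 := by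
      refine (mul_eq_zero_iff_right hsin).mp ?_
      have hangle : ((k : ℤ) + 1 : ℝ) * (2 * (Real.pi / (2 * k + 1 : ℕ))) =
          2 * Real.pi - (((k : ℤ) - 1 : ℤ) + 1 : ℝ) * (2 * (Real.pi / (2 * k + 1 : ℕ))) := by
        push_cast at hm0 ⊢
        field_simp
        ring
      rw [add_mul, hS, hS, hangle, Real.sin_two_pi_sub, neg_add_cancel]
    have h₁ : (((2 * k + 1 : ℕ) : ℤ) - 2) / 2 = k - 1 := by lia
    have h₂ : (((2 * k + 1 : ℕ) : ℤ) - 1) / 2 = k := by lia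
    have h₃ : (((2 * k + 1 : ℕ) : ℤ) - 3) / 2 = k - 1 := by lia
    have h₄ : ((2 * k + 1 : ℕ) : ℤ) / 2 = k := by lia
    simp only [h₁, h₂, h₃, h₄, hzero]
    simp

/-- The coroots of the geometric representation: `⟨α_j, α_i^∨⟩ = -2 cos (π / m_{i,j})`. -/
noncomputable def coroot (M : CoxeterMatrix B) (i : B) : Module.Dual ℝ (B →₀ ℝ) :=
  Finsupp.linearCombination ℝ fun j => -2 * Real.cos (Real.pi / M i j)

theorem coroot_single (M : CoxeterMatrix B) (i j : B) :
    coroot M i (Finsupp.single j 1) = -2 * Real.cos (Real.pi / M i j) := by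
  simp [coroot]

theorem coroot_single_self (M : CoxeterMatrix B) (i : B) :
    coroot M i (Finsupp.single i 1) = 2 := by
  simp [coroot_single]

theorem isLiftable_reflection (M : CoxeterMatrix B) :
    M.IsLiftable fun i => Module.reflection (coroot_single_self M i) := by
  intro i j
  by_cases hij : i = j
  · subst hij
    ext1 z
    simp [Module.involutive_reflection (coroot_single_self M i) z]
  by_cases h0 : M i j = 0
  · simp [h0]
  have h1 := M.off_diagonal i j hij
  refine reflection_mul_reflection_pow_eq_one _ _ ?_ (coroot_single M i j) ?_
  · change M i j ≠ 1 at h1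
    lia
  · rw [coroot_single, M.symmetric]

theorem simple_injective (M : CoxeterMatrix B) : Function.Injective M.simple := by
  intro i j h
  by_contra hij
  have hlift (k : B) : M.toCoxeterSystem.lift ⟨_, isLiftable_reflection M⟩ (M.simple k) =
      Module.reflection (coroot_single_self M k) := by
    rw [← CoxeterMatrix.toCoxeterSystem_simple, CoxeterSystem.lift_apply_simple]
  have hrefl : Module.reflection (coroot_single_self M i) =
      Module.reflection (coroot_single_self M j) := by
    rw [← hlift, h, hlift]
  have happ := DFunLike.congr_fun (DFunLike.congr_fun hrefl (Finsupp.single i 1)) i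
  rw [Module.reflection_apply_self, Module.reflection_apply] at happ
  norm_num [Ne.symm hij] at happ

theorem proj_gen (M : CoxeterMatrix B) (s : B) : proj M (gen M s) = M.simple s :=
  PresentedGroup.toGroup.of (braid_lift M)

theorem IsRibbon.leftMul_eq_rightMul {M : CoxeterMatrix B} {X Y : Set B} {g : Artin M}
    (h : IsRibbon M X Y g) : leftMul M Y g = rightMul M X g := by
  induction h with
  | nil => simp [leftMul, rightMul]
  | @cons Y Z g h _ hYZ ih =>
    obtain ⟨_, _, _, _, hZ⟩ := hYZ
    calc leftMul M Z (h * g) = (· * g) '' leftMul M Z h := by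
          simp [leftMul, Set.image_image, mul_assoc]
      _ = (h * ·) '' leftMul M Y g := by
          rw [hZ]
          simp [leftMul, rightMul, Set.image_image, mul_assoc]
      _ = rightMul M X (h * g) := by
          simp [ih, rightMul, Set.image_image, mul_assoc]

/-- Conjugation by an element of `H_X` permutes the generators in `X`. -/
theorem exists_gen_mul_eq_of_mem_HXset {M : CoxeterMatrix B} {X : Set B} {g : Artin M}
    (hg : g ∈ HXset M X) {t : B} (ht : t ∈ X) :
    ∃ u ∈ X, gen M u * g = g * gen M t := by
  obtain ⟨g₁, g₂, h₁, _, h₂, _, rfl⟩ := hg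
  obtain ⟨v, hv, hv₂⟩ : gen M t * g₂ ∈ rightMul M X g₂ :=
    h₂.leftMul_eq_rightMul ▸ ⟨t, ht, rfl⟩
  obtain ⟨u, hu, hu₁⟩ : g₁ * gen M v ∈ leftMul M X g₁ :=
    h₁.leftMul_eq_rightMul ▸ ⟨v, hv, rfl⟩
  have hv' : gen M v * g₂⁻¹ = g₂⁻¹ * gen M t := by
    rw [mul_inv_eq_iff_eq_mul, mul_assoc, eq_inv_mul_iff_mul_eq]
    exact hv₂
  refine ⟨u, hu, ?_⟩
  change gen M u * g₁ = g₁ * gen M v at hu₁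
  rw [← mul_assoc, hu₁, mul_assoc, hv', mul_assoc]

/-- **Equivalence (5) in the proof of Theorem 3 (Godelle).** For `g ∈ H_X` and `s, t ∈ X`:
`sg = gt` in `A_S` iff `s·p(g) = p(g)·t` in `W_S`. -/
theorem HXset_conj_iff_proj_conj
    [Finite B] (M : CoxeterMatrix B) (hsph : Finite M.Group) (X : Set B)
    (g : Artin M) (hg : g ∈ HXset M X) (s t : B) (hs : s ∈ X) (ht : t ∈ X) :
    gen M s * g = g * gen M t ↔
      M.simple s * proj M g = proj M g * M.simple t := by
  constructor
  · intro h
    simpa [proj_gen] using congrArg (proj M) h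
  · intro h
    obtain ⟨u, _, hug⟩ := exists_gen_mul_eq_of_mem_HXset hg ht
    have hu : M.simple u * proj M g = proj M g * M.simple t := by
      simpa [proj_gen] using congrArg (proj M) hug
    obtain rfl := simple_injective M (mul_right_cancel (h.trans hu.symm))
    exact hug

end ArtinTitsPaper
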